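/- arXiv:2306.05195 — 2 statements merged into one kernel-verified Lean document; each statement's English description precedes it below -/
import Mathlib

section
/- Blindness of the second qubit given the first outcome: fix real angles δ₁ and θ₂ and an outcome m ∈ {0,1}. For θ ∈ ℝ let w_m(θ) = (⟨m_{δ₁}| ⊗ I₂) · CZ · (|+_θ⟩ ⊗ |+_{θ₂}⟩) ∈ ℂ² be the unnormalized post-measurement state of the second qubit (with ⟨0_{δ₁}| = ⟨+_{δ₁}|, ⟨1_{δ₁}| = ⟨−_{δ₁}|). Then the uniform average over the eight protocol angles of the normalized post-measurement density matrices is maximally mixed: (1/8) · Σ_{k=0}^{7} 2 · w_m(kπ/4) · w_m(kπ/4)† = (1/2) · I₂. -/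
open Real Matrix

/-- The rotated plus state `|+_θ⟩ = (1/√2)(e₀ + e^{iθ} e₁)` in `ℂ²`. -/
noncomputable def plusKet (θ : ℝ) : Fin 2 → ℂ :=
  ![(Real.sqrt 2 : ℂ)⁻¹, Complex.exp (θ * Complex.I) * (Real.sqrt 2 : ℂ)⁻¹]

/-- The rotated minus state `|−_θ⟩ = (1/√2)(e₀ − e^{iθ} e₁)` in `ℂ²`. -/
noncomputable def minusKet (θ : ℝ) : Fin 2 → ℂ :=
  ![(Real.sqrt 2 : ℂ)⁻¹, -(Complex.exp (θ * Complex.I) * (Real.sqrt 2 : ℂ)⁻¹)]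

/-- The measurement-basis vector: `|0_δ⟩ = |+_δ⟩` and `|1_δ⟩ = |−_δ⟩`. -/
noncomputable def basisKet (δ : ℝ) (m : Fin 2) : Fin 2 → ℂ :=
  if m = 0 then plusKet δ else minusKet δ

/-- The controlled-Z gate: `−1` on `e₁⊗e₁`, identity elsewhere. -/
def CZ : Matrix (Fin 2 × Fin 2) (Fin 2 × Fin 2) ℂ :=
  Matrix.diagonal (fun p => if p = (1, 1) then -1 else 1)

/-- Partial inner product `⟨v| ⊗ I₂`: contraction of the first tensor factor against
`v` (conjugate-linear in `v`), mapping `ℂ²⊗ℂ²` to `ℂ²`. -/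
noncomputable def contrFst (v : Fin 2 → ℂ) (w : Fin 2 × Fin 2 → ℂ) : Fin 2 → ℂ :=
  fun j => ∑ i, star (v i) * w (i, j)

/-- The tensor product of vectors in `ℂ²`. -/
def tensVec (u v : Fin 2 → ℂ) : Fin 2 × Fin 2 → ℂ := fun p => u p.1 * v p.2

/-- The unnormalized post-measurement state of the second qubit after measuring the
first qubit of `CZ(|+_θ⟩ ⊗ |+_{θ₂}⟩)` with outcome `m` in the `δ₁`-rotated basis. -/
noncomputable def postState (δ₁ θ₂ : ℝ) (m : Fin 2) (θ : ℝ) : Fin 2 → ℂ :=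
  contrFst (basisKet δ₁ m) (CZ.mulVec (tensVec (plusKet θ) (plusKet θ₂)))

lemma exp_conj_mul (x : ℝ) :
    (starRingEnd ℂ) (Complex.exp (x * Complex.I)) * Complex.exp (x * Complex.I) = 1 := by
  rw [← Complex.exp_conj, ← Complex.exp_add]
  simp

lemma exp_add_pi (x : ℝ) :
    Complex.exp (((x + π : ℝ) : ℂ) * Complex.I) = -Complex.exp (x * Complex.I) := by
  push_cast
  rw [add_mul, Complex.exp_add, Complex.exp_pi_mul_I]
  ring

lemma sqrt_two_inv_sq : ((Real.sqrt 2 : ℂ)⁻¹) ^ 2 = 2⁻¹ := by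
  rw [inv_pow, ← Complex.ofReal_pow, Real.sq_sqrt (by norm_num)]
  norm_num

/-- The post-measurement state, written with a sign `e` for the outcome. -/
lemma postState_apply (δ₁ θ₂ : ℝ) (m : Fin 2) : ∃ e : ℂ, e * e = 1 ∧
    (starRingEnd ℂ) e = e ∧ ∀ θ : ℝ, postState δ₁ θ₂ m θ =
    ![(Real.sqrt 2 : ℂ)⁻¹ ^ 3 * (1 + e * (starRingEnd ℂ) (Complex.exp (δ₁ * Complex.I)) *
        Complex.exp (θ * Complex.I)),
      (Real.sqrt 2 : ℂ)⁻¹ ^ 3 * (1 - e * (starRingEnd ℂ) (Complex.exp (δ₁ * Complex.I)) *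
        Complex.exp (θ * Complex.I)) * Complex.exp (θ₂ * Complex.I)] := by
  fin_cases m
  · refine ⟨1, by simp, by simp, fun θ => ?_⟩
    ext j
    fin_cases j <;>
    simp [postState, contrFst, basisKet, CZ, Matrix.mulVec_diagonal, tensVec, plusKet,
      -Complex.exp_conj, ← Complex.exp_conj] <;> ring
  · refine ⟨-1, by simp, by simp, fun θ => ?_⟩
    ext j
    fin_cases j <;>
    simp [postState, contrFst, basisKet, CZ, Matrix.mulVec_diagonal, tensVec, plusKet,
      minusKet, ← Complex.exp_conj] <;> ring

/-- Opposite angles average to the maximally mixed state. -/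
lemma pair_sum (δ₁ θ₂ : ℝ) (m : Fin 2) (x y : ℝ) (hy : y = x + π) :
    Matrix.vecMulVec (postState δ₁ θ₂ m x) (star (postState δ₁ θ₂ m x)) +
    Matrix.vecMulVec (postState δ₁ θ₂ m y) (star (postState δ₁ θ₂ m y)) =
      (2 : ℂ)⁻¹ • (1 : Matrix (Fin 2) (Fin 2) ℂ) := by
  subst hy
  obtain ⟨e, he, hce, h⟩ := postState_apply δ₁ θ₂ m
  rw [h, h, exp_add_pi]
  have h1 := exp_conj_mul δ₁
  have h2 := exp_conj_mul θ₂
  have h3 := exp_conj_mul x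
  have hs := sqrt_two_inv_sq
  have hcs : (starRingEnd ℂ) (Real.sqrt 2 : ℂ) = (Real.sqrt 2 : ℂ) := Complex.conj_ofReal _
  generalize Complex.exp (δ₁ * Complex.I) = d at *
  generalize Complex.exp (θ₂ * Complex.I) = t at *
  generalize Complex.exp (x * Complex.I) = a at *
  have hs6 : ((Real.sqrt 2 : ℂ)⁻¹) ^ 6 = 8⁻¹ := by
    rw [show ((Real.sqrt 2 : ℂ)⁻¹) ^ 6 = (((Real.sqrt 2 : ℂ)⁻¹) ^ 2) ^ 3 by ring, hs]; norm_num
  ext i j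
  fin_cases i <;> fin_cases j <;>
    simp only [Matrix.add_apply, Matrix.vecMulVec_apply, Matrix.smul_apply, Pi.star_apply,
      Complex.star_def, Fin.zero_eta, Fin.mk_one, Matrix.cons_val_zero, Matrix.cons_val_one,
      map_mul, map_add, map_sub, map_neg, map_one, map_pow, map_inv₀, hcs, hce,
      Complex.conj_conj, Matrix.one_apply, smul_eq_mul] <;>
    generalize (starRingEnd ℂ) d = d' at * <;>
    generalize (starRingEnd ℂ) t = t' at * <;>
    generalize (starRingEnd ℂ) a = a' at * <;>
    generalize ((Real.sqrt 2 : ℂ)⁻¹) = s at * <;> simp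
  all_goals
    have hp : (e * d' * a) * (e * d * a') = 1 := by
      linear_combination (d' * a * d * a') * he + (a * a') * h1 + h3
    generalize e * d' * a = p at *
    generalize e * d * a' = q at *
  · linear_combination (2 + 2 * p * q) * hs6 + (1/4) * hp
  · linear_combination (2 * s ^ 6 * t') * (-hp)
  · linear_combination (2 * s ^ 6 * t) * (-hp)
  · linear_combination (2 + 2 * p * q) * t * t' * hs6 + (1/4) * t * t' * hp + (1/2) * h2

/-- Blindness of the second qubit given the first outcome: the uniform average over the
eight protocol angles of the normalized post-measurement density matrices
`2 · w_m(kπ/4) · w_m(kπ/4)†` is the maximally mixed state `(1/2)·I₂`. -/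
theorem second_qubit_blindness (δ₁ θ₂ : ℝ) (m : Fin 2) :
    (8 : ℂ)⁻¹ • ∑ k : Fin 8,
        (2 : ℂ) • Matrix.vecMulVec (postState δ₁ θ₂ m (((k : ℕ) : ℝ) * π / 4))
          (star (postState δ₁ θ₂ m (((k : ℕ) : ℝ) * π / 4))) =
      (2 : ℂ)⁻¹ • (1 : Matrix (Fin 2) (Fin 2) ℂ) := by
  rw [← Finset.smul_sum, Fin.sum_univ_eight]
  have p0 := pair_sum δ₁ θ₂ m (((0 : Fin 8) : ℕ) * π / 4) (((4 : Fin 8) : ℕ) * π / 4)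
    (by simp)
  have p1 := pair_sum δ₁ θ₂ m (((1 : Fin 8) : ℕ) * π / 4) (((5 : Fin 8) : ℕ) * π / 4)
    (by simp; ring)
  have p2 := pair_sum δ₁ θ₂ m (((2 : Fin 8) : ℕ) * π / 4) (((6 : Fin 8) : ℕ) * π / 4)
    (by simp; ring)
  have p3 := pair_sum δ₁ θ₂ m (((3 : Fin 8) : ℕ) * π / 4) (((7 : Fin 8) : ℕ) * π / 4)
    (by simp; ring)
  linear_combination (norm := module) (8 : ℂ)⁻¹ • (2 : ℂ) • (p0 + p1 + p2 + p3)
end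

section
/- Correctness of the two-qubit UBQC protocol with adaptive measurement: let φ₁, φ₂, θ₁, θ₂ be real angles and r₁, r₂ ∈ {0,1}. For corrected outcomes s₁, s₂ ∈ {0,1} define the encrypted-run joint probability p_enc(s₁,s₂) = ‖(P^{s₁⊕r₁}_{δ₁} ⊗ P^{s₂⊕r₂}_{δ₂}) · CZ · (|+_{θ₁}⟩ ⊗ |+_{θ₂}⟩)‖², where δ₁ = φ₁ + θ₁ + r₁π and δ₂ = (−1)^{s₁}·φ₂ + θ₂ + r₂π, and the plain-run probability p_plain(s₁,s₂) = ‖(P^{s₁}_{φ₁} ⊗ P^{s₂}_{(−1)^{s₁}φ₂}) · CZ · (|+⟩ ⊗ |+⟩)‖², where |+⟩ = |+_0⟩. Then p_enc(s₁,s₂) = p_plain(s₁,s₂) for all s₁, s₂ ∈ {0,1}; i.e., the distribution of the corrected outcomes (m₁ ⊕ r₁, m₂ ⊕ r₂) in the encrypted, randomized execution equals the outcome distribution of the unencrypted measurement pattern with angles φ₁, φ₂. -/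
open Real Matrix Kronecker

/-- The rank-one projector `P^s_δ` of the `δ`-rotated measurement basis:
`P⁰_δ = |+_δ⟩⟨+_δ|` and `P¹_δ = |−_δ⟩⟨−_δ|`. -/
noncomputable def proj (δ : ℝ) (s : Fin 2) : Matrix (Fin 2) (Fin 2) ℂ :=
  Matrix.vecMulVec (basisKet δ s) (star (basisKet δ s))

/-- Diagonal of the phase rotation by `θ`. -/
noncomputable def phaseD (θ : ℝ) : Fin 2 → ℂ := ![1, Complex.exp (θ * Complex.I)]

lemma phaseD_normSq (θ : ℝ) (i : Fin 2) : Complex.normSq (phaseD θ i) = 1 := by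
  rw [Complex.normSq_eq_norm_sq]
  fin_cases i <;> simp [phaseD, Complex.norm_exp_ofReal_mul_I]

lemma phaseD_star_mul (θ : ℝ) (i : Fin 2) : star (phaseD θ i) * phaseD θ i = 1 := by
  have h := Complex.normSq_eq_conj_mul_self (z := phaseD θ i)
  rw [phaseD_normSq] at h
  simpa using h.symm

lemma plusKet_phase (θ : ℝ) (i : Fin 2) : plusKet θ i = phaseD θ i * plusKet 0 i := by
  fin_cases i <;> simp [plusKet, phaseD]

lemma basisKet_phase (a θ : ℝ) (s i : Fin 2) :
    basisKet (a + θ) s i = phaseD θ i * basisKet a s i := by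
  fin_cases s <;> fin_cases i <;>
    simp [basisKet, plusKet, minusKet, phaseD, add_mul, Complex.exp_add] <;> ring

lemma basisKet_flip (a : ℝ) (s r : Fin 2) :
    basisKet (a + ((r : ℕ) : ℝ) * π) (s + r) = basisKet a s := by
  funext i
  fin_cases s <;> fin_cases r <;> fin_cases i <;>
    simp [basisKet, plusKet, minusKet, add_mul, Complex.exp_add, Complex.exp_pi_mul_I]

lemma proj_phase (a θ : ℝ) (s r i j : Fin 2) :
    proj (a + θ + ((r : ℕ) : ℝ) * π) (s + r) i j =
      phaseD θ i * star (phaseD θ j) * proj a s i j := by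
  simp only [proj, basisKet_flip, Matrix.vecMulVec_apply, Pi.star_apply, basisKet_phase, star_mul]
  ring

/-- Correctness of the two-qubit UBQC protocol with adaptive measurement: the joint
distribution of the corrected outcomes `(s₁, s₂) = (m₁ ⊕ r₁, m₂ ⊕ r₂)` in the
encrypted, randomized execution (angles `δ₁ = φ₁ + θ₁ + r₁π`,
`δ₂ = (−1)^{s₁}φ₂ + θ₂ + r₂π`, initial states `|+_{θ₁}⟩ ⊗ |+_{θ₂}⟩`) equals the outcome
distribution of the unencrypted pattern with angles `φ₁, (−1)^{s₁}φ₂` on `|+⟩ ⊗ |+⟩`. -/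
theorem ubqc_two_qubit_correctness (φ₁ φ₂ θ₁ θ₂ : ℝ) (r₁ r₂ s₁ s₂ : Fin 2) :
    ∑ p, Complex.normSq
        (((proj (φ₁ + θ₁ + ((r₁ : ℕ) : ℝ) * π) (s₁ + r₁) ⊗ₖ
            proj ((-1 : ℝ) ^ (s₁ : ℕ) * φ₂ + θ₂ + ((r₂ : ℕ) : ℝ) * π) (s₂ + r₂)).mulVec
          (CZ.mulVec (tensVec (plusKet θ₁) (plusKet θ₂)))) p) =
      ∑ p, Complex.normSq
        (((proj φ₁ s₁ ⊗ₖ proj ((-1 : ℝ) ^ (s₁ : ℕ) * φ₂) s₂).mulVec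
          (CZ.mulVec (tensVec (plusKet 0) (plusKet 0)))) p) := by
  have key : ∀ p : Fin 2 × Fin 2,
      ((proj (φ₁ + θ₁ + ((r₁ : ℕ) : ℝ) * π) (s₁ + r₁) ⊗ₖ
            proj ((-1 : ℝ) ^ (s₁ : ℕ) * φ₂ + θ₂ + ((r₂ : ℕ) : ℝ) * π) (s₂ + r₂)).mulVec
          (CZ.mulVec (tensVec (plusKet θ₁) (plusKet θ₂)))) p =
      phaseD θ₁ p.1 * phaseD θ₂ p.2 *
        ((proj φ₁ s₁ ⊗ₖ proj ((-1 : ℝ) ^ (s₁ : ℕ) * φ₂) s₂).mulVec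
          (CZ.mulVec (tensVec (plusKet 0) (plusKet 0)))) p := by
    intro p
    simp only [Matrix.mulVec, dotProduct, Finset.mul_sum]
    refine Finset.sum_congr rfl fun q _ => Finset.sum_congr rfl fun t _ => ?_
    simp only [Matrix.kroneckerMap_apply, proj_phase, CZ, Matrix.diagonal_apply]
    by_cases h : q = t
    · subst h
      simp only [tensVec, plusKet_phase θ₁, plusKet_phase θ₂, if_true]
      have h1 := phaseD_star_mul θ₁ q.1
      have h2 := phaseD_star_mul θ₂ q.2
      generalize star (phaseD θ₁ q.1) = x at *
      generalize star (phaseD θ₂ q.2) = y at *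
      generalize phaseD θ₁ q.1 = x' at *
      generalize phaseD θ₂ q.2 = y' at *
      generalize (if q = (1, 1) then (-1 : ℂ) else 1) = c
      generalize proj φ₁ s₁ p.1 q.1 = A
      generalize proj ((-1 : ℝ) ^ (s₁ : ℕ) * φ₂) s₂ p.2 q.2 = B
      generalize phaseD θ₁ p.1 = d
      generalize phaseD θ₂ p.2 = e
      generalize plusKet 0 q.1 = u
      generalize plusKet 0 q.2 = v
      calc _ = (x * x') * (y * y') * (d * e * (A * B * (c * (u * v)))) := by ring
        _ = _ := by rw [h1, h2]; ring
    · simp [h]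
  refine Finset.sum_congr rfl fun p _ => ?_
  rw [key p, Complex.normSq_mul, Complex.normSq_mul, phaseD_normSq, phaseD_normSq]
  simp
end
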